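/- Let r₀ > 0, let Ω̃ ⊆ {(r,θ) ∈ ℝ² : r > r₀} be open and bounded, with ∂Ω̃ a one-dimensional C¹ submanifold of ℝ², and assume every point of ∂Ω̃ satisfies the interior ball condition. Let λ ≥ 0 be a real number and let u : ℝ² → ℝ be continuously differentiable on an open neighborhood of the closure of Ω̃, twice continuously differentiable on Ω̃, with Lu + λ·u = 0 on Ω̃ and u = 0 on ∂Ω̃. Then for every P ∈ ∂Ω̃: fderiv u P = 0 if and only if P belongs to the closure of {p ∈ Ω̃ : u(p) = 0}. -/

import Mathlib

/-- Partial derivative in the first coordinate direction. -/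
noncomputable def pd1 (f : ℝ × ℝ → ℝ) (p : ℝ × ℝ) : ℝ := fderiv ℝ f p (1, 0)

/-- Partial derivative in the second coordinate direction. -/
noncomputable def pd2 (f : ℝ × ℝ → ℝ) (p : ℝ × ℝ) : ℝ := fderiv ℝ f p (0, 1)

/-- The polar-form elliptic operator
`(Lu)(r,θ) = ∂²u/∂r² + (1/r²)·∂²u/∂θ² + (1/r)·∂u/∂r`. -/
noncomputable def Lpolar (u : ℝ × ℝ → ℝ) (p : ℝ × ℝ) : ℝ :=
  pd1 (pd1 u) p + (1 / p.1 ^ 2) * pd2 (pd2 u) p + (1 / p.1) * pd1 u p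

/-- `M` is a one-dimensional C¹ submanifold of `ℝ²`: near each of its points it is
the image of a regular C¹ local parametrization. -/
def IsC1Submanifold1D (M : Set (ℝ × ℝ)) : Prop :=
  ∀ Q ∈ M, ∃ (U : Set (ℝ × ℝ)) (γ : ℝ → ℝ × ℝ) (ε : ℝ),
    0 < ε ∧ IsOpen U ∧ Q ∈ U ∧
    ContDiffOn ℝ 1 γ (Set.Ioo (-ε) ε) ∧ γ 0 = Q ∧
    deriv γ 0 ≠ 0 ∧ γ '' Set.Ioo (-ε) ε = M ∩ U

/-- `P` satisfies the interior ball condition for `Ω`: there is an open (Euclidean)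
ball contained in `Ω` whose boundary contains `P`. -/
def InteriorBall (Ω : Set (ℝ × ℝ)) (P : ℝ × ℝ) : Prop :=
  ∃ (c : ℝ × ℝ) (ρ : ℝ), 0 < ρ ∧
    {x : ℝ × ℝ | (x.1 - c.1) ^ 2 + (x.2 - c.2) ^ 2 < ρ ^ 2} ⊆ Ω ∧
    (P.1 - c.1) ^ 2 + (P.2 - c.2) ^ 2 = ρ ^ 2

/-- A function with a local minimum has nonnegative second derivative there. -/
lemma IsLocalMin.second_deriv_nonneg {f f' : ℝ → ℝ} {a k : ℝ} (hmin : IsLocalMin f a)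
    (hf : ∀ᶠ t in nhds a, HasDerivAt f (f' t) t) (hf' : HasDerivAt f' k a) : 0 ≤ k := by
  by_contra! hk
  have hdf : deriv f =ᶠ[nhds a] f' := hf.mono fun t ht => ht.deriv
  have h2 : deriv (deriv f) a = k := by rw [hdf.deriv_eq, hf'.deriv]
  have hmax : IsLocalMax f a :=
    isLocalMax_of_deriv_deriv_neg (by rw [h2]; exact hk) hmin.deriv_eq_zero
      hf.self_of_nhds.continuousAt
  have hconst : f =ᶠ[nhds a] fun _ => f a := by
    filter_upwards [hmin, hmax] with t h1 h2 using le_antisymm h2 h1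
  have h0 : deriv (deriv f) a = 0 := by
    rw [hconst.deriv.deriv_eq]; simp
  linarith

/-- A function vanishing at `0` and nonnegative on `[0, 1]` has nonnegative derivative at `0`. -/
lemma HasDerivAt.nonneg_of_nonneg_on_Icc {g : ℝ → ℝ} {k : ℝ} (hg : HasDerivAt g k 0)
    (h0 : g 0 = 0) (hnn : ∀ t ∈ Set.Icc (0 : ℝ) 1, 0 ≤ g t) : 0 ≤ k := by
  have ht := (hasDerivAt_iff_tendsto_slope.1 hg).mono_left
    (nhdsWithin_mono 0 fun x (hx : x ∈ Set.Ioi (0 : ℝ)) => ne_of_gt hx)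
  refine ge_of_tendsto ht ?_
  filter_upwards [Ioo_mem_nhdsGT (zero_lt_one : (0 : ℝ) < 1)] with t ht
  rw [slope_def_field, h0]
  have := hnn t ⟨ht.1.le, ht.2.le⟩
  have := ht.1
  simp only [sub_zero]
  positivity

lemma ContDiffOn.differentiableAt_fderiv_apply {u : ℝ × ℝ → ℝ} {B : Set (ℝ × ℝ)} (hB : IsOpen B)
    (hu : ContDiffOn ℝ 2 u B) {p : ℝ × ℝ} (hp : p ∈ B) (w : ℝ × ℝ) :
    DifferentiableAt ℝ (fun q => fderiv ℝ u q w) p := by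
  have h1 : ContDiffAt ℝ 1 (fderiv ℝ u) p :=
    (hu.contDiffAt (hB.mem_nhds hp)).fderiv_right (by norm_num)
  exact (h1.differentiableAt (by norm_num)).clm_apply (differentiableAt_const w)

lemma DifferentiableAt.hasDerivAt_fst {f : ℝ × ℝ → ℝ} {p : ℝ × ℝ} (h : DifferentiableAt ℝ f p) :
    HasDerivAt (fun t => f (t, p.2)) (pd1 f p) p.1 :=
  HasFDerivAt.comp_hasDerivAt (f := fun t : ℝ => (t, p.2)) p.1 h.hasFDerivAt
    ((hasDerivAt_id p.1).prodMk (hasDerivAt_const p.1 p.2))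

lemma DifferentiableAt.hasDerivAt_snd {f : ℝ × ℝ → ℝ} {p : ℝ × ℝ} (h : DifferentiableAt ℝ f p) :
    HasDerivAt (fun t => f (p.1, t)) (pd2 f p) p.2 :=
  HasFDerivAt.comp_hasDerivAt (f := fun t : ℝ => (p.1, t)) p.2 h.hasFDerivAt
    ((hasDerivAt_const p.2 p.1).prodMk (hasDerivAt_id p.2))

lemma hasDerivAt_exp_barrier (α a d t : ℝ) :
    HasDerivAt (fun t => Real.exp (α * (d - (t - a) ^ 2)) - 1)
      (-2 * α * (t - a) * Real.exp (α * (d - (t - a) ^ 2))) t := by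
  have h : HasDerivAt (fun t => α * (d - (t - a) ^ 2)) (α * (-(2 * (t - a)))) t := by
    have := ((((hasDerivAt_id t).sub_const a).pow 2).const_sub d).const_mul α
    simpa using this
  exact (h.exp.sub_const 1).congr_deriv (by ring)

lemma hasDerivAt_exp_barrier_deriv (α a d t : ℝ) :
    HasDerivAt (fun t => -2 * α * (t - a) * Real.exp (α * (d - (t - a) ^ 2)))
      ((-2 * α + 4 * α ^ 2 * (t - a) ^ 2) * Real.exp (α * (d - (t - a) ^ 2))) t := by
  have h1 : HasDerivAt (fun t => -2 * α * (t - a)) (-2 * α) t := by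
    simpa using ((hasDerivAt_id t).sub_const a).const_mul (-2 * α)
  have h2 := (hasDerivAt_exp_barrier α a d t).add_const 1
  simp only [sub_add_cancel] at h2
  exact (h1.mul h2).congr_deriv (by ring)

/-- Second-order conditions at a local minimum of `u` minus a multiple of a one-variable slice
of the exponential barrier. -/
lemma slice_conditions {f f' : ℝ → ℝ} {a k ε α b d : ℝ}
    (hmin : IsLocalMin (fun t => f t - ε * (Real.exp (α * (d - (t - b) ^ 2)) - 1)) a)
    (hf : ∀ᶠ t in nhds a, HasDerivAt f (f' t) t) (hf' : HasDerivAt f' k a) :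
    f' a = ε * (-2 * α * (a - b) * Real.exp (α * (d - (a - b) ^ 2))) ∧
      ε * ((-2 * α + 4 * α ^ 2 * (a - b) ^ 2) * Real.exp (α * (d - (a - b) ^ 2))) ≤ k := by
  have h1 : ∀ᶠ t in nhds a, HasDerivAt
      (fun t => f t - ε * (Real.exp (α * (d - (t - b) ^ 2)) - 1))
      (f' t - ε * (-2 * α * (t - b) * Real.exp (α * (d - (t - b) ^ 2)))) t :=
    hf.mono fun t ht => ht.sub ((hasDerivAt_exp_barrier α b d t).const_mul ε)
  have h2 := hf'.sub ((hasDerivAt_exp_barrier_deriv α b d a).const_mul ε)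
  have h3 := hmin.second_deriv_nonneg h1 h2
  have h4 := hmin.hasDerivAt_eq_zero h1.self_of_nhds
  constructor <;> linarith

/-- Hopf boundary point lemma for `Lpolar` on a Euclidean disc. -/
lemma hopf_Lpolar {r₀ : ℝ} (hr₀ : 0 < r₀) {c P : ℝ × ℝ} {ρ : ℝ} (hρ : 0 < ρ)
    (hP : (P.1 - c.1) ^ 2 + (P.2 - c.2) ^ 2 = ρ ^ 2) {u : ℝ × ℝ → ℝ}
    (hcont : ContinuousOn u {x | (x.1 - c.1) ^ 2 + (x.2 - c.2) ^ 2 ≤ ρ ^ 2})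
    (hr : ∀ x : ℝ × ℝ, (x.1 - c.1) ^ 2 + (x.2 - c.2) ^ 2 < ρ ^ 2 → r₀ < x.1)
    (hpos : ∀ x : ℝ × ℝ, (x.1 - c.1) ^ 2 + (x.2 - c.2) ^ 2 < ρ ^ 2 → 0 < u x)
    (hnn : ∀ x : ℝ × ℝ, (x.1 - c.1) ^ 2 + (x.2 - c.2) ^ 2 ≤ ρ ^ 2 → 0 ≤ u x)
    (hu2 : ContDiffOn ℝ 2 u {x | (x.1 - c.1) ^ 2 + (x.2 - c.2) ^ 2 < ρ ^ 2})
    (hL : ∀ x : ℝ × ℝ, (x.1 - c.1) ^ 2 + (x.2 - c.2) ^ 2 < ρ ^ 2 → Lpolar u x ≤ 0)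
    (huP : u P = 0) : ¬ HasFDerivAt u (0 : ℝ × ℝ →L[ℝ] ℝ) P := by
  intro hd
  have hcompact : ∀ s : ℝ, IsCompact {x : ℝ × ℝ | (x.1 - c.1) ^ 2 + (x.2 - c.2) ^ 2 ≤ s ^ 2} := by
    intro s
    refine Metric.isCompact_of_isClosed_isBounded
      (isClosed_le (by fun_prop) (by fun_prop)) ?_
    refine (Metric.isBounded_closedBall (x := c) (r := |s|)).subset fun x hx => ?_
    have hx' : (x.1 - c.1) ^ 2 + (x.2 - c.2) ^ 2 ≤ s ^ 2 := hx
    rw [Metric.mem_closedBall, Prod.dist_eq, Real.dist_eq, Real.dist_eq]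
    refine max_le (sq_le_sq.1 ?_) (sq_le_sq.1 ?_) <;>
      nlinarith [sq_nonneg (x.1 - c.1), sq_nonneg (x.2 - c.2)]
  have hopen : IsOpen {x : ℝ × ℝ | (x.1 - c.1) ^ 2 + (x.2 - c.2) ^ 2 < ρ ^ 2} :=
    isOpen_lt (by fun_prop) (by fun_prop)
  obtain ⟨m, hm, hmu⟩ : ∃ m, 0 < m ∧
      ∀ x : ℝ × ℝ, (x.1 - c.1) ^ 2 + (x.2 - c.2) ^ 2 ≤ (ρ / 2) ^ 2 → m ≤ u x := by
    obtain ⟨y, hy, hmin⟩ := (hcompact (ρ / 2)).exists_isMinOn ⟨c, by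
      change (c.1 - c.1) ^ 2 + (c.2 - c.2) ^ 2 ≤ (ρ / 2) ^ 2
      simp only [sub_self]; nlinarith⟩
      (hcont.mono fun x hx => by
        simp only [Set.mem_ofPred_eq] at hx ⊢; nlinarith)
    refine ⟨u y, hpos y ?_, fun x hx => hmin hx⟩
    have : (y.1 - c.1) ^ 2 + (y.2 - c.2) ^ 2 ≤ (ρ / 2) ^ 2 := hy
    nlinarith
  set R : ℝ := c.1 + ρ with hR
  have hRpos : 0 < R := by
    have := hr c (by simp only [sub_self]; nlinarith)
    linarith
  set μ : ℝ := min (r₀ ^ 2) 1 with hμ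
  have hμpos : 0 < μ := by positivity
  set α : ℝ := (2 * R ^ 2 + 2 + 2 * R * ρ + 1) / (μ * ρ ^ 2) with hα
  have hαpos : 0 < α := by positivity
  have hαμ : α * (μ * ρ ^ 2) = 2 * R ^ 2 + 2 + 2 * R * ρ + 1 := by
    rw [hα]; field_simp
  set ε : ℝ := m / Real.exp (α * ρ ^ 2) with hε
  have hεpos : 0 < ε := by positivity
  have hεm : ε * Real.exp (α * ρ ^ 2) = m := by rw [hε]; field_simp
  set v : ℝ × ℝ → ℝ := fun x =>
    u x - ε * (Real.exp (α * (ρ ^ 2 - (x.1 - c.1) ^ 2 - (x.2 - c.2) ^ 2)) - 1) with hv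
  have hvcont : ContinuousOn v {x | (x.1 - c.1) ^ 2 + (x.2 - c.2) ^ 2 ≤ ρ ^ 2} :=
    hcont.sub (Continuous.continuousOn (by fun_prop))
  have hvnn : ∀ x : ℝ × ℝ, (x.1 - c.1) ^ 2 + (x.2 - c.2) ^ 2 ≤ ρ ^ 2 → 0 ≤ v x := by
    obtain ⟨y, hy, hmin⟩ := (hcompact ρ).exists_isMinOn ⟨P, hP.le⟩ hvcont
    have hy' : (y.1 - c.1) ^ 2 + (y.2 - c.2) ^ 2 ≤ ρ ^ 2 := hy
    suffices h : 0 ≤ v y from fun x hx => h.trans (hmin hx)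
    rcases le_or_gt ((y.1 - c.1) ^ 2 + (y.2 - c.2) ^ 2) ((ρ / 2) ^ 2) with hin | hin
    · have h1 := hmu y hin
      have h2 : Real.exp (α * (ρ ^ 2 - (y.1 - c.1) ^ 2 - (y.2 - c.2) ^ 2)) ≤
          Real.exp (α * ρ ^ 2) := by
        apply Real.exp_le_exp.2
        apply mul_le_mul_of_nonneg_left _ hαpos.le
        nlinarith [sq_nonneg (y.1 - c.1), sq_nonneg (y.2 - c.2)]
      have h3 := mul_le_mul_of_nonneg_left h2 hεpos.le
      simp only [hv]
      linarith
    rcases hy'.lt_or_eq with hlt | heq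
    · exfalso
      have hloc : IsLocalMin v y :=
        hmin.isLocalMin (Filter.mem_of_superset (hopen.mem_nhds hlt) fun x hx => le_of_lt (Set.mem_ofPred_eq ▸ hx))
      have hdiff : ∀ᶠ x in nhds y, DifferentiableAt ℝ u x := by
        filter_upwards [hopen.mem_nhds hlt] with x hx
        exact (hu2.contDiffAt (hopen.mem_nhds hx)).differentiableAt (by norm_num)
      have ht1 : Filter.Tendsto (fun t : ℝ => (t, y.2)) (nhds y.1) (nhds y) :=
        Continuous.tendsto (f := fun t : ℝ => (t, y.2)) (by fun_prop) y.1
      have ht2 : Filter.Tendsto (fun t : ℝ => (y.1, t)) (nhds y.2) (nhds y) :=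
        Continuous.tendsto (f := fun t : ℝ => (y.1, t)) (by fun_prop) y.2
      obtain ⟨hA, hB⟩ := slice_conditions (f := fun t => u (t, y.2))
        (f' := fun t => pd1 u (t, y.2)) (a := y.1) (k := pd1 (pd1 u) y)
        (ε := ε) (α := α) (b := c.1) (d := ρ ^ 2 - (y.2 - c.2) ^ 2)
        (by
          have := ht1.eventually hloc
          simp only [hv] at this
          filter_upwards [this] with t ht
          simpa only [sub_right_comm] using ht)
        (by
          filter_upwards [ht1.eventually hdiff] with t ht
          exact DifferentiableAt.hasDerivAt_fst ht)
        (DifferentiableAt.hasDerivAt_fst (hu2.differentiableAt_fderiv_apply hopen hlt (1, 0)))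
      obtain ⟨-, hC⟩ := slice_conditions (f := fun t => u (y.1, t))
        (f' := fun t => pd2 u (y.1, t)) (a := y.2) (k := pd2 (pd2 u) y)
        (ε := ε) (α := α) (b := c.2) (d := ρ ^ 2 - (y.1 - c.1) ^ 2)
        (by
          have := ht2.eventually hloc
          simp only [hv] at this
          filter_upwards [this] with t ht using ht)
        (by
          filter_upwards [ht2.eventually hdiff] with t ht
          exact DifferentiableAt.hasDerivAt_snd ht)
        (DifferentiableAt.hasDerivAt_snd (hu2.differentiableAt_fderiv_apply hopen hlt (0, 1)))
      rw [sub_right_comm] at hA hB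
      have hry := hr y hlt
      have hy1 : 0 < y.1 := hr₀.trans hry
      have hLy := hL y hlt
      have hLy' : y.1 ^ 2 * pd1 (pd1 u) y + pd2 (pd2 u) y + y.1 * pd1 u y ≤ 0 := by
        have : y.1 ^ 2 * Lpolar u y =
            y.1 ^ 2 * pd1 (pd1 u) y + pd2 (pd2 u) y + y.1 * pd1 u y := by
          unfold Lpolar; field_simp
        rw [← this]
        exact mul_nonpos_of_nonneg_of_nonpos (by positivity) hLy
      simp only [Prod.mk.eta] at hA
      set X := y.1 - c.1 with hX
      set Y := y.2 - c.2 with hY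
      set E := Real.exp (α * (ρ ^ 2 - X ^ 2 - Y ^ 2)) with hE
      have hEpos : 0 < E := Real.exp_pos _
      have hXρ : |X| ≤ ρ := abs_le_of_sq_le_sq (by nlinarith [sq_nonneg Y]) hρ.le
      have hyR : y.1 ≤ R := by
        have := (abs_le.1 hXρ).2
        linarith
      have hmain : 0 < -(2 * y.1 ^ 2) - 2 - 2 * y.1 * X + 4 * α * (y.1 ^ 2 * X ^ 2 + Y ^ 2) := by
        have h1 : y.1 ^ 2 ≤ R ^ 2 := by gcongr
        have h2 : y.1 * X ≤ R * ρ := by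
          have h3 : y.1 * X ≤ y.1 * ρ := by
            apply mul_le_mul_of_nonneg_left (abs_le.1 hXρ).2 hy1.le
          have h4 : y.1 * ρ ≤ R * ρ := by gcongr
          linarith
        have h5 : μ ≤ y.1 ^ 2 := (min_le_left _ _).trans (by gcongr)
        have h6 : μ ≤ 1 := min_le_right _ _
        have h7 : μ * (X ^ 2 + Y ^ 2) ≤ y.1 ^ 2 * X ^ 2 + Y ^ 2 := by
          linarith [mul_le_mul_of_nonneg_right h5 (sq_nonneg X),
            mul_le_mul_of_nonneg_right h6 (sq_nonneg Y)]
        have h8 : μ * ρ ^ 2 ≤ 4 * (y.1 ^ 2 * X ^ 2 + Y ^ 2) := by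
          linarith [mul_le_mul_of_nonneg_left hin.le hμpos.le]
        have h9 := mul_le_mul_of_nonneg_left h8 hαpos.le
        linarith
      have hprod : 0 < ε * α * E *
          (-(2 * y.1 ^ 2) - 2 - 2 * y.1 * X + 4 * α * (y.1 ^ 2 * X ^ 2 + Y ^ 2)) := by positivity
      rw [hA] at hLy'
      have h10 := mul_le_mul_of_nonneg_left hB (sq_nonneg y.1)
      linarith
    · have h0 : ρ ^ 2 - (y.1 - c.1) ^ 2 - (y.2 - c.2) ^ 2 = 0 := by linarith
      simp only [hv, h0, mul_zero, Real.exp_zero, sub_self, sub_zero]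
      exact hnn y hy'
  have hcurve : HasDerivAt (fun t : ℝ => P + t • (c - P)) (c - P) 0 := by
    simpa using ((hasDerivAt_id (0 : ℝ)).smul_const (c - P)).const_add P
  have hu' : HasDerivAt (fun t : ℝ => u (P + t • (c - P))) 0 0 := by
    exact HasFDerivAt.comp_hasDerivAt (f := fun t : ℝ => P + t • (c - P)) (0 : ℝ)
      (l' := 0) (l := u) (by simpa using hd) hcurve
  have hb : HasDerivAt (fun t : ℝ => Real.exp (α * ρ ^ 2 * (1 - (t - 1) ^ 2)) - 1)
      (2 * (α * ρ ^ 2)) 0 := by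
    have := hasDerivAt_exp_barrier (α * ρ ^ 2) 1 1 0
    exact this.congr_deriv (by norm_num)
  have hg := hu'.sub (hb.const_mul ε)
  have hge := hg.nonneg_of_nonneg_on_Icc (by simp [huP]) (by
    intro t ht
    have hsq : (P.1 + t * (c.1 - P.1) - c.1) ^ 2 + (P.2 + t * (c.2 - P.2) - c.2) ^ 2 =
        (t - 1) ^ 2 * ρ ^ 2 := by
      rw [← hP]; ring
    have hx := hvnn (P + t • (c - P)) (by
      simp only [Prod.fst_add, Prod.snd_add, Prod.smul_fst, Prod.smul_snd, Prod.fst_sub,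
        Prod.snd_sub, smul_eq_mul]
      rw [hsq]
      nlinarith [mul_nonneg (mul_nonneg ht.1 (by linarith [ht.2] : 0 ≤ 2 - t)) (sq_nonneg ρ)])
    simp only [hv, Prod.fst_add, Prod.snd_add, Prod.smul_fst, Prod.smul_snd, Prod.fst_sub,
      Prod.snd_sub, smul_eq_mul] at hx
    rw [sub_sub (ρ ^ 2), hsq] at hx
    have hexp : α * (ρ ^ 2 - (t - 1) ^ 2 * ρ ^ 2) = α * ρ ^ 2 * (1 - (t - 1) ^ 2) := by ring
    rw [hexp] at hx
    exact hx)
  have : 0 < ε * (2 * (α * ρ ^ 2)) := by positivity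
  linarith

lemma Lpolar_neg (u : ℝ × ℝ → ℝ) (p : ℝ × ℝ) : Lpolar (-u) p = -Lpolar u p := by
  have h1 : ∀ f : ℝ × ℝ → ℝ, pd1 (-f) = -pd1 f := fun f => by
    ext q; simp [pd1, fderiv_neg]
  have h2 : ∀ f : ℝ × ℝ → ℝ, pd2 (-f) = -pd2 f := fun f => by
    ext q; simp [pd2, fderiv_neg]
  simp only [Lpolar, h1, h2, Pi.neg_apply]
  ring

lemma convex_disc (c : ℝ × ℝ) (s : ℝ) :
    Convex ℝ {x : ℝ × ℝ | (x.1 - c.1) ^ 2 + (x.2 - c.2) ^ 2 < s} := by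
  have h : ConvexOn ℝ Set.univ fun t : ℝ => t ^ 2 := (even_two).convexOn_pow
  have h1 : ConvexOn ℝ Set.univ fun x : ℝ × ℝ => (x.1 - c.1) ^ 2 :=
    h.comp_affineMap ((LinearMap.fst ℝ ℝ ℝ).toAffineMap - AffineMap.const ℝ (ℝ × ℝ) c.1)
  have h2 : ConvexOn ℝ Set.univ fun x : ℝ × ℝ => (x.2 - c.2) ^ 2 :=
    h.comp_affineMap ((LinearMap.snd ℝ ℝ ℝ).toAffineMap - AffineMap.const ℝ (ℝ × ℝ) c.2)
  simpa using (h1.add h2).convex_lt s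

/-- If the differential of a `C¹` function `u` vanishing on a `C¹` curve is nonzero at a point of
the curve, then the zero set of `u` near that point lies on the curve. -/
lemma eventually_mem_curve_of_fderiv_ne_zero {u : ℝ × ℝ → ℝ} {γ : ℝ → ℝ × ℝ}
    (hu : ContDiffAt ℝ 1 u (γ 0)) (hγ : ContDiffAt ℝ 1 γ 0) (hγ' : deriv γ 0 ≠ 0)
    {S : Set ℝ} (hS : S ∈ nhds (0 : ℝ)) (huγ : ∀ t ∈ S, u (γ t) = 0)
    (hne : fderiv ℝ u (γ 0) ≠ 0) :
    ∀ᶠ x in nhds (γ 0), u x = 0 → x ∈ γ '' S := by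
  set v := deriv γ 0 with hv
  set D := fderiv ℝ u (γ 0) with hD
  have hγs : HasStrictDerivAt γ v 0 := hγ.hasStrictDerivAt (by norm_num)
  have hus : HasStrictFDerivAt u D (γ 0) := hu.hasStrictFDerivAt (by norm_num)
  have hDv : D v = 0 := by
    have h1 : HasDerivAt (fun t => u (γ t)) (D v) 0 :=
      HasFDerivAt.comp_hasDerivAt (0 : ℝ) hus.hasFDerivAt hγs.hasDerivAt
    have h2 : (fun t => u (γ t)) =ᶠ[nhds 0] fun _ => (0 : ℝ) := by
      filter_upwards [hS] with t ht using huγ t ht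
    exact h1.unique ((hasDerivAt_const (0 : ℝ) (0 : ℝ)).congr_of_eventuallyEq h2)
  have hvpos : 0 < v.1 * v.1 + v.2 * v.2 := by
    by_contra! h
    have h1 : v.1 = 0 := by nlinarith [mul_self_nonneg v.1, mul_self_nonneg v.2]
    have h2 : v.2 = 0 := by nlinarith [mul_self_nonneg v.1, mul_self_nonneg v.2]
    exact hγ' (Prod.ext h1 h2)
  set w : ℝ × ℝ := (-v.2, v.1) with hw
  have hdecomp : ∀ z : ℝ × ℝ, (v.1 * v.1 + v.2 * v.2) • z =
      (v.1 * z.1 + v.2 * z.2) • v + (v.1 * z.2 - v.2 * z.1) • w := by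
    intro z
    ext <;> simp [hw] <;> ring
  have hDw : D w ≠ 0 := by
    intro h0
    apply hne
    ext
    · have h := congrArg D (hdecomp (1, 0))
      simp only [map_add, map_smul, hDv, h0, smul_zero, add_zero] at h
      simpa using (smul_eq_zero.1 h).resolve_left hvpos.ne'
    · have h := congrArg D (hdecomp (0, 1))
      simp only [map_add, map_smul, hDv, h0, smul_zero, add_zero] at h
      simpa using (smul_eq_zero.1 h).resolve_left hvpos.ne'
  have hwn : 0 < ‖w‖ := norm_pos_iff.2 fun h => hDw (by rw [h, map_zero])
  set ℓ : ℝ × ℝ → ℝ := fun z => v.1 * z.1 + v.2 * z.2 with hℓ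
  have hℓγ : HasStrictDerivAt (fun t => ℓ (γ t)) (v.1 * v.1 + v.2 * v.2) 0 := by
    have hf : HasStrictDerivAt (fun t => (γ t).1) v.1 0 :=
      (ContinuousLinearMap.fst ℝ ℝ ℝ).hasStrictFDerivAt.comp_hasStrictDerivAt 0 hγs
    have hs : HasStrictDerivAt (fun t => (γ t).2) v.2 0 :=
      (ContinuousLinearMap.snd ℝ ℝ ℝ).hasStrictFDerivAt.comp_hasStrictDerivAt 0 hγs
    exact (hf.const_mul v.1).add (hs.const_mul v.2)
  have hlittle := hus.isLittleO.def (c := |D w| / (2 * ‖w‖)) (by positivity)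
  rw [nhds_prod_eq] at hlittle
  obtain ⟨pa, hpa, pb, hpb, hab⟩ := Filter.eventually_prod_iff.1 hlittle
  have hT : {t | t ∈ S ∧ pb (γ t)} ∈ nhds (0 : ℝ) :=
    Filter.inter_mem hS (hγs.hasDerivAt.continuousAt.eventually hpb)
  have himg : (fun t => ℓ (γ t)) '' {t | t ∈ S ∧ pb (γ t)} ∈ nhds (ℓ (γ 0)) := by
    rw [← hℓγ.map_nhds_eq hvpos.ne']
    exact Filter.image_mem_map hT
  have hℓc : ContinuousAt ℓ (γ 0) := by
    apply Continuous.continuousAt; fun_prop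
  filter_upwards [hpa, hℓc.preimage_mem_nhds himg] with x hx hxl hux
  obtain ⟨t, ⟨htS, htb⟩, hteq⟩ := hxl
  refine ⟨t, htS, ?_⟩
  have hest := hab hx htb
  simp only [hux, huγ t htS, sub_self, zero_sub, norm_neg] at hest
  set z := x - γ t with hz
  have hlz : v.1 * z.1 + v.2 * z.2 = 0 := by
    simp only [hℓ] at hteq
    simp only [hz, Prod.fst_sub, Prod.snd_sub]
    linarith
  have hzw := hdecomp z
  rw [hlz, zero_smul, zero_add] at hzw
  set N := v.1 * v.1 + v.2 * v.2
  set s := v.1 * z.2 - v.2 * z.1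
  have hN1 : N * ‖D z‖ = |s| * |D w| := by
    have := congrArg (fun q => ‖D q‖) hzw
    simpa [norm_smul, abs_of_pos hvpos] using this
  have hN2 : N * ‖z‖ = |s| * ‖w‖ := by
    have := congrArg (fun q => ‖q‖) hzw
    simpa only [norm_smul, Real.norm_eq_abs, abs_of_pos hvpos] using this
  have h1 : |s| * |D w| ≤ |s| * |D w| / 2 := by
    calc |s| * |D w| = N * ‖D z‖ := hN1.symm
      _ ≤ N * (|D w| / (2 * ‖w‖) * ‖z‖) := mul_le_mul_of_nonneg_left hest hvpos.le
      _ = |D w| / (2 * ‖w‖) * (N * ‖z‖) := by ring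
      _ = |s| * |D w| / 2 := by rw [hN2]; field_simp
  have hDwpos : 0 < |D w| := abs_pos.2 hDw
  have hs0 : |s| = 0 := by
    by_contra h
    have : 0 < |s| := lt_of_le_of_ne (abs_nonneg _) (Ne.symm h)
    have := mul_pos this hDwpos
    linarith
  rw [hs0, zero_mul] at hN2
  have hz0 : z = 0 := norm_eq_zero.1 ((mul_eq_zero.1 hN2).resolve_left hvpos.ne')
  exact (sub_eq_zero.1 hz0).symm


theorem normal_derivative_zero_iff_in_nodal_set_polar
    (r₀ : ℝ) (hr₀ : 0 < r₀)
    (Ω : Set (ℝ × ℝ)) (hΩsub : ∀ p ∈ Ω, r₀ < p.1)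
    (hΩ : IsOpen Ω) (hΩbd : Bornology.IsBounded Ω)
    (hman : IsC1Submanifold1D (frontier Ω))
    (hballs : ∀ P ∈ frontier Ω, InteriorBall Ω P)
    (lam : ℝ) (hlam : 0 ≤ lam)
    (u : ℝ × ℝ → ℝ)
    (V : Set (ℝ × ℝ)) (hV : IsOpen V) (hclV : closure Ω ⊆ V)
    (hu1 : ContDiffOn ℝ 1 u V) (hu2 : ContDiffOn ℝ 2 u Ω)
    (heq : ∀ p ∈ Ω, Lpolar u p + lam * u p = 0)
    (hbc : ∀ p ∈ frontier Ω, u p = 0) :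
    ∀ P ∈ frontier Ω, (fderiv ℝ u P = 0 ↔ P ∈ closure {p ∈ Ω | u p = 0}) := by
  intro P hP
  have hPV : P ∈ V := hclV (frontier_subset_closure hP)
  have huPd : DifferentiableAt ℝ u P :=
    (hu1.contDiffAt (hV.mem_nhds hPV)).differentiableAt (by norm_num)
  constructor
  · intro hd
    by_contra hcl
    obtain ⟨δ, hδ, hδsub⟩ := Metric.isOpen_iff.1 isClosed_closure.isOpen_compl P hcl
    obtain ⟨c, ρ, hρ, hBΩ, hPc⟩ := hballs P hP
    set T : Set (ℝ × ℝ) :=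
      {x : ℝ × ℝ | (x.1 - c.1) ^ 2 + (x.2 - c.2) ^ 2 < ρ ^ 2} ∩ Metric.ball P δ with hT
    have hTne : ∀ x ∈ T, u x ≠ 0 := fun x hx h0 =>
      hδsub hx.2 (subset_closure ⟨hBΩ hx.1, h0⟩)
    have hTcont : ContinuousOn u T :=
      hu1.continuousOn.mono fun x hx => hclV (subset_closure (hBΩ hx.1))
    have hTconn : IsPreconnected T :=
      ((convex_disc c (ρ ^ 2)).inter (convex_ball P δ)).isPreconnected
    set s : ℝ := min (1 / 2) (δ / (4 * ρ)) with hs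
    have hs0 : 0 < s := by positivity
    have hs1 : s ≤ 1 / 2 := min_le_left _ _
    have hsδ : s * (4 * ρ) ≤ δ := by
      rw [← le_div_iff₀ (by positivity)]; exact min_le_right _ _
    set c' : ℝ × ℝ := (P.1 + s * (c.1 - P.1), P.2 + s * (c.2 - P.2)) with hc'
    have hsρ : 0 < s * ρ := by positivity
    have hPc' : (P.1 - c'.1) ^ 2 + (P.2 - c'.2) ^ 2 = (s * ρ) ^ 2 := by
      simp only [hc']
      rw [mul_pow, ← hPc]; ring
    have hsub : ∀ x : ℝ × ℝ, (x.1 - c'.1) ^ 2 + (x.2 - c'.2) ^ 2 ≤ (s * ρ) ^ 2 →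
        x ≠ P → x ∈ T := by
      intro x hx hxP
      have hpos : 0 < (x.1 - P.1) ^ 2 + (x.2 - P.2) ^ 2 := by
        by_contra! h
        apply hxP
        ext <;> nlinarith [sq_nonneg (x.1 - P.1), sq_nonneg (x.2 - P.2)]
      -- the identity `s |x - c|² = |x - c'|² - s² ρ² + s ρ² - (1 - s) |x - P|²`
      have hid : s * ((x.1 - c.1) ^ 2 + (x.2 - c.2) ^ 2) =
          (x.1 - c'.1) ^ 2 + (x.2 - c'.2) ^ 2 - (s * ρ) ^ 2 + s * ρ ^ 2
            - (1 - s) * ((x.1 - P.1) ^ 2 + (x.2 - P.2) ^ 2) := by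
        simp only [hc']
        rw [mul_pow, ← hPc]; ring
      constructor
      · have h1 : 0 < (1 - s) * ((x.1 - P.1) ^ 2 + (x.2 - P.2) ^ 2) :=
          mul_pos (by linarith) hpos
        have h2 : s * ((x.1 - c.1) ^ 2 + (x.2 - c.2) ^ 2) < s * ρ ^ 2 := by linarith
        exact lt_of_mul_lt_mul_left h2 hs0.le
      · have hb : ∀ a b d : ℝ, (a - d) ^ 2 ≤ (s * ρ) ^ 2 → (b - d) ^ 2 ≤ (s * ρ) ^ 2 →
            |a - b| < δ := by
          intro a b d h1 h2
          have h1' := abs_le.1 (abs_le_of_sq_le_sq h1 hsρ.le)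
          have h2' := abs_le.1 (abs_le_of_sq_le_sq h2 hsρ.le)
          rw [abs_lt]
          constructor <;> linarith [h1'.1, h1'.2, h2'.1, h2'.2]
        rw [Metric.mem_ball, Prod.dist_eq, Real.dist_eq, Real.dist_eq]
        refine max_lt (hb _ _ c'.1 ?_ ?_) (hb _ _ c'.2 ?_ ?_)
        · linarith [sq_nonneg (x.2 - c'.2)]
        · linarith [sq_nonneg (P.2 - c'.2)]
        · linarith [sq_nonneg (x.1 - c'.1)]
        · linarith [sq_nonneg (P.1 - c'.1)]
    have hsub' : ∀ x : ℝ × ℝ, (x.1 - c'.1) ^ 2 + (x.2 - c'.2) ^ 2 < (s * ρ) ^ 2 → x ∈ T :=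
      fun x hx => hsub x hx.le fun h => by rw [h] at hx; linarith
    have hTΩ : ∀ x ∈ T, x ∈ Ω := fun x hx => hBΩ hx.1
    have huP := hbc P hP
    have hclosed : ∀ x : ℝ × ℝ, (x.1 - c'.1) ^ 2 + (x.2 - c'.2) ^ 2 ≤ (s * ρ) ^ 2 → x ∈ V := by
      intro x hx
      by_cases h : x = P
      · rwa [h]
      · exact hclV (subset_closure (hTΩ x (hsub x hx h)))
    have hcontV : ContinuousOn u {x | (x.1 - c'.1) ^ 2 + (x.2 - c'.2) ^ 2 ≤ (s * ρ) ^ 2} :=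
      hu1.continuousOn.mono hclosed
    have hu2B : ContDiffOn ℝ 2 u {x | (x.1 - c'.1) ^ 2 + (x.2 - c'.2) ^ 2 < (s * ρ) ^ 2} :=
      hu2.mono fun x hx => hTΩ x (hsub' x hx)
    have hdP : HasFDerivAt u (0 : ℝ × ℝ →L[ℝ] ℝ) P := hd ▸ huPd.hasFDerivAt
    have hsign : (∀ x ∈ T, 0 < u x) ∨ (∀ x ∈ T, u x < 0) := by
      by_contra! h
      obtain ⟨⟨x, hx, hx0⟩, y, hy, hy0⟩ := h
      obtain ⟨z, hz, hz0⟩ := hTconn.intermediate_value hx hy hTcont ⟨hx0, hy0⟩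
      exact hTne z hz hz0
    rcases hsign with hpos | hneg
    · refine hopf_Lpolar hr₀ hsρ hPc' hcontV (fun x hx => hΩsub x (hTΩ x (hsub' x hx)))
        (fun x hx => hpos x (hsub' x hx)) (fun x hx => ?_) hu2B (fun x hx => ?_) huP hdP
      · by_cases h : x = P
        · rw [h, huP]
        · exact (hpos x (hsub x hx h)).le
      · have h1 := heq x (hTΩ x (hsub' x hx))
        have h2 := mul_nonneg hlam (hpos x (hsub' x hx)).le
        linarith
    · refine hopf_Lpolar (u := -u) hr₀ hsρ hPc' hcontV.neg
        (fun x hx => hΩsub x (hTΩ x (hsub' x hx)))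
        (fun x hx => neg_pos.2 (hneg x (hsub' x hx))) (fun x hx => ?_) hu2B.neg
        (fun x hx => ?_) (by simp [huP]) (by simpa using hdP.neg)
      · by_cases h : x = P
        · simp [h, huP]
        · exact (neg_pos.2 (hneg x (hsub x hx h))).le
      · have h1 := heq x (hTΩ x (hsub' x hx))
        have h2 := mul_nonneg hlam (neg_pos.2 (hneg x (hsub' x hx))).le
        rw [Lpolar_neg]
        linarith
  · intro hcl
    by_contra hne
    obtain ⟨U, γ, η, hη, -, -, hγ, rfl, hγ', himg⟩ := hman P hP
    have hmem : Set.Ioo (-η) η ∈ nhds (0 : ℝ) := Ioo_mem_nhds (by linarith) hη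
    have hfr : ∀ x ∈ γ '' Set.Ioo (-η) η, x ∈ frontier Ω := fun x hx => by
      rw [himg] at hx; exact hx.1
    have hev := eventually_mem_curve_of_fderiv_ne_zero (hu1.contDiffAt (hV.mem_nhds hPV))
      (hγ.contDiffAt hmem) hγ' hmem (fun t ht => hbc _ (hfr _ ⟨t, ht, rfl⟩)) hne
    obtain ⟨x, ⟨hxΩ, hx0⟩, hx⟩ := ((mem_closure_iff_frequently.1 hcl).and_eventually hev).exists
    exact (hΩ.frontier_eq ▸ hfr x (hx hx0)).2 hxΩ
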